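/- arXiv:2303.01262 — 6 statements merged into one kernel-verified Lean document; each statement's English description precedes it below -/
import Mathlib

section
/- Let D be a nonempty dataset contained in [l, u] with n = |D|, and set w = u − l, m = (l+u)/2, and s = Σ_{x ∈ D} (x − m). Let Z_n and Z_s be independent real random variables, where Z_n has probability density z ↦ (ε/4)·exp(−ε|z|/2) (Laplace with scale 2/ε) and Z_s has density z ↦ (ε/(2w))·exp(−ε|z|/w) (Laplace with scale w/ε), for some ε > 0. Define μ̂ = clip((s + Z_s)/(n + Z_n), [−w/2, w/2]) + m. Then E|μ̂ − μ(D)| ≤ 3(u − l)/(nε). -/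
open MeasureTheory ProbabilityTheory Multiset
open scoped ProbabilityTheory

noncomputable section

/-- Add/remove distance between multisets. -/
def mdist (D D' : Multiset ℝ) : ℕ := (D - D').card + (D' - D).card

/-- Neighboring datasets. -/
def Neighboring (D D' : Multiset ℝ) : Prop := mdist D D' = 1

/-- `A` is an `ε`-differentially private randomized algorithm. -/
def IsDP (A : Multiset ℝ → Measure ℝ) (ε : ℝ) : Prop :=
  (∀ D, IsProbabilityMeasure (A D)) ∧
  ∀ D D' : Multiset ℝ, Neighboring D D' → ∀ S : Set ℝ, MeasurableSet S →
    A D S ≤ ENNReal.ofReal (Real.exp ε) * A D' S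

/-- Mean of a dataset. -/
def mmean (D : Multiset ℝ) : ℝ := D.sum / D.card

/-- The multiset of the `m` smallest elements of `D`. -/
def lowerM (m : ℕ) (D : Multiset ℝ) : Multiset ℝ := ((D.sort (· ≤ ·)).take m : List ℝ)

/-- The multiset of the `m` largest elements of `D`. -/
def upperM (m : ℕ) (D : Multiset ℝ) : Multiset ℝ := ((D.sort (· ≤ ·)).drop (D.card - m) : List ℝ)

/-- Subset-based risk for mean estimation. -/
def meanRisk (D : Multiset ℝ) (ε : ℝ) : ℝ :=
  ⨅ A : {A : Multiset ℝ → Measure ℝ // IsDP A ε},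
    ⨆ D' : {D' : Multiset ℝ // D' ≤ D ∧ (D.card : ℝ) - 1/ε ≤ D'.card},
      ∫ y, |y - mmean D'.1| ∂(A.1 D'.1)
/-- Clip a real number to the interval `[a, b]`. -/
def clip (x a b : ℝ) : ℝ := min (max x a) b

/-- First absolute moment of a Laplace random variable with rate `c`. -/
theorem integrable_abs_and_integral_abs_of_map_eq_laplace
    {Ω : Type*} [MeasurableSpace Ω] {P : Measure Ω} {Z : Ω → ℝ} (hZ : AEMeasurable Z P)
    {c : ℝ} (hc : 0 < c)
    (hmap : Measure.map Z P = volume.withDensity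
      (fun z => ENNReal.ofReal (c / 2 * Real.exp (-(c * |z|))))) :
    Integrable (fun ω => |Z ω|) P ∧ ∫ ω, |Z ω| ∂P = 1 / c := by
  have hint : ∫ ω, |Z ω| ∂P = 1 / c := by
    have hpos : ∫ x in Set.Ioi (0 : ℝ), x * Real.exp (-(c * x)) = 1 / c ^ 2 := by
      have h := Real.integral_rpow_mul_exp_neg_mul_Ioi (a := 2) (r := c) (by norm_num) hc
      norm_num [Real.Gamma_two] at h
      rw [h]
      norm_num
    rw [← integral_map (f := fun z : ℝ => |z|) hZ (by fun_prop), hmap,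
      integral_withDensity_eq_integral_toReal_smul (by fun_prop) (by simp)]
    have hdens : ∀ z : ℝ,
        (ENNReal.ofReal (c / 2 * Real.exp (-(c * |z|)))).toReal • |z|
          = c / 2 * (|z| * Real.exp (-(c * |z|))) := by
      intro z
      rw [ENNReal.toReal_ofReal (by positivity), smul_eq_mul]
      ring
    simp_rw [hdens]
    rw [integral_const_mul, integral_comp_abs (f := fun x => x * Real.exp (-(c * x))), hpos]
    field_simp
  refine ⟨?_, hint⟩
  by_contra hni
  rw [integral_undef hni] at hint
  exact (one_div_pos.mpr hc).ne hint

/-- A ratio with perturbed numerator and denominator, clipped to `[-h, h]`, stays close to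
the unperturbed ratio `a` whenever `a ∈ [-h, h]`. -/
theorem mul_abs_clip_div_sub_le {n a h x y : ℝ} (ha : |a| ≤ h) :
    n * |clip ((n * a + x) / (n + y)) (-h) h - a| ≤ |x| + 2 * h * |y| := by
  obtain ⟨ha₁, ha₂⟩ := abs_le.mp ha
  have hh : 0 ≤ h := (abs_nonneg a).trans ha
  set q := (n * a + x) / (n + y) with hq
  set r := clip q (-h) h with hr
  have hr₁ : -h ≤ r := le_min (le_max_right _ _) (by linarith)
  have hr₂ : r ≤ h := min_le_right _ _
  rcases le_or_gt (n + y) 0 with hny | hny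
  · have hy : n ≤ |y| := by linarith [neg_le_abs y]
    have he : |r - a| ≤ 2 * h := abs_le.mpr ⟨by linarith, by linarith⟩
    calc n * |r - a| ≤ |y| * (2 * h) := by gcongr
      _ ≤ |x| + 2 * h * |y| := by linarith [abs_nonneg x]
  · have hqe : q * (n + y) = n * a + x := div_mul_cancel₀ _ hny.ne'
    have hry : |r * y| ≤ h * |y| := by
      rw [abs_mul]
      gcongr
      exact abs_le.mpr ⟨hr₁, hr₂⟩
    have hhy : 0 ≤ h * |y| := by positivity
    obtain ⟨hry₁, hry₂⟩ := abs_le.mp hry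
    rcases le_total a r with har | har
    · rw [abs_of_nonneg (by linarith)]
      have hle : r ≤ q ∨ r = a := by
        rcases le_or_gt (-h) q with hhq | hhq
        · exact .inl ((min_le_left _ _).trans (max_le le_rfl hhq))
        · refine .inr (le_antisymm ?_ har)
          exact (min_le_left _ _).trans (max_le (by linarith) ha₁)
      rcases hle with hle | hle
      · nlinarith [mul_le_mul_of_nonneg_right hle hny.le, le_abs_self x]
      · rw [hle]
        linarith [abs_nonneg x]
    · rw [abs_of_nonpos (by linarith)]
      have hle : q ≤ r ∨ r = a := by
        rcases le_or_gt q h with hhq | hhq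
        · exact .inl (le_min (le_max_left _ _) hhq)
        · refine .inr (le_antisymm har ?_)
          exact le_min (le_max_of_le_left (by linarith)) ha₂
      rcases hle with hle | hle
      · nlinarith [mul_le_mul_of_nonneg_right hle hny.le, neg_le_abs x]
      · rw [hle]
        linarith [abs_nonneg x]

theorem card_mul_mmean {D : Multiset ℝ} (hD : D ≠ 0) : (D.card : ℝ) * mmean D = D.sum :=
  mul_div_cancel₀ _ (by simpa using hD)

theorem mmean_mem_Icc {D : Multiset ℝ} (hD : D ≠ 0) {l u : ℝ}
    (hmem : ∀ x ∈ D, x ∈ Set.Icc l u) : mmean D ∈ Set.Icc l u := by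
  have hn : (0 : ℝ) < D.card := by exact_mod_cast Multiset.card_pos.mpr hD
  have hl := Multiset.card_nsmul_le_sum (s := D) (a := l) fun x hx => (hmem x hx).1
  have hu := Multiset.sum_le_card_nsmul D u fun x hx => (hmem x hx).2
  rw [nsmul_eq_mul] at hl hu
  exact ⟨(le_div_iff₀ hn).mpr (by linarith), (div_le_iff₀ hn).mpr (by linarith)⟩

/-- utility of the bounded mean estimation algorithm with Laplace noise on
the count and on the shifted sum: `E|μ̂ − μ(D)| ≤ 3(u − l)/(nε)`. -/
theorem bounded_mean_estimation_utility
    {Ω : Type*} [MeasureSpace Ω] [IsProbabilityMeasure (ℙ : Measure Ω)]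
    (D : Multiset ℝ) (hD : D ≠ 0) (l u : ℝ) (hlu : l < u)
    (hmem : ∀ x ∈ D, x ∈ Set.Icc l u) (ε : ℝ) (hε : 0 < ε)
    (Zn Zs : Ω → ℝ) (hZnm : Measurable Zn) (hZsm : Measurable Zs)
    (hindep : ProbabilityTheory.IndepFun Zn Zs ℙ)
    (hZn : Measure.map Zn ℙ = volume.withDensity
      (fun z => ENNReal.ofReal (ε / 4 * Real.exp (-(ε * |z|) / 2))))
    (hZs : Measure.map Zs ℙ = volume.withDensity
      (fun z => ENNReal.ofReal (ε / (2 * (u - l)) * Real.exp (-(ε * |z|) / (u - l)))))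
    (μhat : Ω → ℝ)
    (hμhat : ∀ ω, μhat ω =
      clip (((D.map (fun x => x - (l + u) / 2)).sum + Zs ω) / ((D.card : ℝ) + Zn ω))
        (-(u - l) / 2) ((u - l) / 2) + (l + u) / 2) :
    ∫ ω, |μhat ω - mmean D| ∂ℙ ≤ 3 * (u - l) / ((D.card : ℝ) * ε) := by
  have hw : 0 < u - l := sub_pos.mpr hlu
  have hn : (0 : ℝ) < D.card := by exact_mod_cast Multiset.card_pos.mpr hD
  obtain ⟨hiN, hEN⟩ := integrable_abs_and_integral_abs_of_map_eq_laplace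
    hZnm.aemeasurable (c := ε / 2) (by positivity) (by
      rw [hZn]
      congr! 4 with z
      · ring
      · congr 1
        ring)
  obtain ⟨hiS, hES⟩ := integrable_abs_and_integral_abs_of_map_eq_laplace
    hZsm.aemeasurable (c := ε / (u - l)) (by positivity) (by
      rw [hZs]
      congr! 4 with z
      · field_simp
      · congr 1
        ring)
  have hsum : (D.map (fun x => x - (l + u) / 2)).sum
      = D.card * (mmean D - (l + u) / 2) := by
    rw [Multiset.sum_map_sub, mul_sub, card_mul_mmean hD]
    simp
  obtain ⟨hml, hmu⟩ := mmean_mem_Icc hD hmem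
  have hbound : ∀ ω, |μhat ω - mmean D| ≤ (|Zs ω| + (u - l) * |Zn ω|) / D.card := by
    intro ω
    have h := mul_abs_clip_div_sub_le (n := D.card) (a := mmean D - (l + u) / 2)
      (h := (u - l) / 2) (x := Zs ω) (y := Zn ω)
      (abs_le.mpr ⟨by linarith, by linarith⟩)
    rw [le_div_iff₀ hn, hμhat, hsum, neg_div, mul_comm, add_sub_assoc,
      ← neg_sub (mmean D), ← sub_eq_add_neg]
    linarith
  calc ∫ ω, |μhat ω - mmean D| ∂ℙ
      ≤ ∫ ω, (|Zs ω| + (u - l) * |Zn ω|) / D.card ∂ℙ :=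
        integral_mono_of_nonneg (.of_forall fun _ => abs_nonneg _)
          ((hiS.add (hiN.const_mul _)).div_const _) (.of_forall hbound)
    _ = 3 * (u - l) / (D.card * ε) := by
        rw [integral_div, integral_add hiS (hiN.const_mul _), integral_const_mul, hES, hEN]
        field_simp
        ring
end
end

section
/- Let Z = {z₁ ≤ … ≤ z_m} be a grid with z_{i+1} = z_i + γ for all i, and let D be a dataset supported on Z. Suppose τ̂ ∈ [z₁, z_m] is a (γ/3, β)-approximate rank-r threshold for D, i.e., there exists τ' with |τ̂ − τ'| ≤ γ/3 and rankerror(τ', r, D) ≤ β. Then the closest point τ̃ ∈ Z to τ̂ satisfies rankerror(τ̃, r, D) ≤ β; in particular, τ̃ is a (0, β)-approximate rank-r threshold for D. -/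
open MeasureTheory Multiset

noncomputable section

/-- Number of elements of `D` strictly below `τ` (with multiplicity). -/
def countLt (D : Multiset ℝ) (τ : ℝ) : ℕ := (D.filter (fun x => x < τ)).card

/-- Number of elements of `D` at most `τ` (with multiplicity). -/
def countLe (D : Multiset ℝ) (τ : ℝ) : ℕ := (D.filter (fun x => x ≤ τ)).card

/-- `τ` is a rank-`r` threshold for `D`: at most `r` points are strictly below `τ`
and at least `r` points are at most `τ`. -/
def IsRankThreshold (τ : ℝ) (r : ℕ) (D : Multiset ℝ) : Prop :=
  countLt D τ ≤ r ∧ r ≤ countLe D τ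

/-- `ranks τ D` is the set of ranks `r ∈ {0, …, |D|}` for which `τ` is a rank-`r`
threshold for `D`. -/
def ranks (τ : ℝ) (D : Multiset ℝ) : Set ℕ := {r | r ≤ D.card ∧ IsRankThreshold τ r D}

/-- `rankerror τ r D = min_{r' ∈ ranks(τ, D)} |r − r'|`. -/
def rankerror (τ r : ℝ) (D : Multiset ℝ) : ℝ :=
  sInf ((fun r' : ℕ => |r - (r' : ℝ)|) '' ranks τ D)

/-- The windowed loss `ℓ(τ) = min_{τ' ∈ [τ−α, τ+α]} rankerror(τ', r, D)`. -/
def winLoss (α r : ℝ) (D : Multiset ℝ) (τ : ℝ) : ℝ :=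
  sInf ((fun τ' => rankerror τ' r D) '' Set.Icc (τ - α) (τ + α))

/-- `τ` is an `(α, β)`-approximate rank-`r` threshold for `D`. -/
def IsApproxRankThreshold (α β τ r : ℝ) (D : Multiset ℝ) : Prop :=
  ∃ τ', |τ - τ'| ≤ α ∧ rankerror τ' r D ≤ β

/-- The continuous exponential mechanism on `[a, b]` with privacy parameter `ε` and
loss function `loss`: the distribution with density proportional to
`exp(−(ε/2) loss τ)` on `[a, b]`. -/
def expMech (a b ε : ℝ) (loss : ℝ → ℝ) : Measure ℝ :=
  (volume.restrict (Set.Icc a b)).withDensity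
    (fun τ => ENNReal.ofReal (Real.exp (-(ε/2) * loss τ) /
      ∫ τ' in Set.Icc a b, Real.exp (-(ε/2) * loss τ')))
/-- A grid with constant step is the arithmetic progression starting at its first point. -/
theorem grid_eq_add_mul {m : ℕ} (hm : 0 < m) {z : Fin m → ℝ} {γ : ℝ}
    (hstep : ∀ i : Fin m, ∀ h : (i : ℕ) + 1 < m, z ⟨(i : ℕ) + 1, h⟩ = z i + γ)
    (k : ℕ) (hk : k < m) : z ⟨k, hk⟩ = z ⟨0, hm⟩ + k * γ := by
  induction k with
  | zero => simp
  | succ k ih =>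
    have h := hstep ⟨k, by omega⟩ hk
    rw [ih] at h
    rw [h]
    push_cast
    ring

/-- Every point between two points `a` and `a + n * γ` is within `γ / 2` of some
`a + k * γ` with `k ≤ n`. -/
theorem exists_abs_sub_add_mul_le {a γ t : ℝ} (hγ : 0 < γ) {n : ℕ}
    (ha : a ≤ t) (ht : t ≤ a + n * γ) :
    ∃ k : ℕ, k ≤ n ∧ |t - (a + k * γ)| ≤ γ / 2 := by
  have hx : (t - a) / γ * γ = t - a := div_mul_cancel₀ _ hγ.ne'
  set x := (t - a) / γ
  have hx0 : 0 ≤ x := div_nonneg (by linarith) hγ.le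
  have hxn : x ≤ n := le_of_mul_le_mul_right (by linarith) hγ
  obtain ⟨h1, h2⟩ := abs_le.mp (abs_sub_round x)
  have hr0 : -1 < round x := by
    have : (-1 : ℝ) < (round x : ℝ) := by linarith
    exact_mod_cast this
  have hrn : round x < n + 1 := by
    have : (round x : ℝ) < n + 1 := by linarith
    exact_mod_cast this
  obtain ⟨k, hk⟩ := Int.eq_ofNat_of_zero_le (show 0 ≤ round x by omega)
  rw [hk] at h1 h2
  push_cast at h1 h2
  refine ⟨k, by omega, abs_le.mpr ⟨?_, ?_⟩⟩ <;> nlinarith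

/-- If every data point below `τ` is below `τ'` and every data point at most `τ'` is at most
`τ`, then every rank of `τ'` is a rank of `τ`. -/
theorem ranks_subset_ranks {τ τ' : ℝ} {D : Multiset ℝ}
    (hlt : ∀ x ∈ D, x < τ → x < τ') (hle : ∀ x ∈ D, x ≤ τ' → x ≤ τ) :
    ranks τ' D ⊆ ranks τ D := by
  rintro s ⟨hs, h1, h2⟩
  have key : ∀ p q : ℝ → Prop, [DecidablePred p] → [DecidablePred q] →
      (∀ x ∈ D, p x → q x) → (D.filter p).card ≤ (D.filter q).card := by
    intro p q _ _ h
    exact Multiset.card_le_card (Multiset.le_filter.mpr ⟨Multiset.filter_le _ _, fun x hx =>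
      h x (Multiset.mem_of_mem_filter hx) (Multiset.of_mem_filter hx)⟩)
  exact ⟨hs, (key _ _ hlt).trans h1, h2.trans (key _ _ hle)⟩

theorem ranks_nonempty (τ : ℝ) (D : Multiset ℝ) : (ranks τ D).Nonempty :=
  ⟨countLe D τ, Multiset.card_le_card (Multiset.filter_le _ _),
    Multiset.card_le_card (Multiset.monotone_filter_right D fun _ h => le_of_lt h), le_rfl⟩

theorem rankerror_le_of_ranks_subset {τ τ' : ℝ} {D : Multiset ℝ} (h : ranks τ' D ⊆ ranks τ D)
    (r : ℝ) : rankerror τ r D ≤ rankerror τ' r D :=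
  csInf_le_csInf ⟨0, by rintro _ ⟨s, -, rfl⟩; exact abs_nonneg _⟩
    ((ranks_nonempty τ' D).image _) (Set.image_mono h)

/-- rounding an approximate rank-`r` threshold for a grid-supported
dataset to the nearest grid point yields a `(0, β)`-approximate rank-`r` threshold. -/
theorem grid_rounding_threshold
    (m : ℕ) (hm : 0 < m) (z : Fin m → ℝ) (γ : ℝ) (hγ : 0 < γ)
    (hstep : ∀ i : Fin m, ∀ h : (i : ℕ) + 1 < m, z ⟨(i : ℕ) + 1, h⟩ = z i + γ)
    (D : Multiset ℝ) (hsupp : ∀ x ∈ D, ∃ i : Fin m, x = z i)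
    (r β : ℝ) (τhat : ℝ)
    (hτhat : τhat ∈ Set.Icc (z ⟨0, hm⟩) (z ⟨m - 1, Nat.sub_lt hm one_pos⟩))
    (happrox : ∃ τ', |τhat - τ'| ≤ γ / 3 ∧ rankerror τ' r D ≤ β)
    (τtilde : ℝ) (hmem : ∃ i : Fin m, τtilde = z i)
    (hclosest : ∀ i : Fin m, |τhat - τtilde| ≤ |τhat - z i|) :
    rankerror τtilde r D ≤ β ∧ IsApproxRankThreshold 0 β τtilde r D := by
  suffices h : rankerror τtilde r D ≤ β from ⟨h, τtilde, by simp, h⟩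
  obtain ⟨τ', hτ', herr⟩ := happrox
  obtain ⟨j, rfl⟩ := hmem
  have hz := grid_eq_add_mul hm hstep
  have hdist : |τhat - z j| ≤ γ / 2 := by
    obtain ⟨k, hk, hkd⟩ := exists_abs_sub_add_mul_le hγ hτhat.1 (hτhat.2.trans_eq (hz _ _))
    refine (hclosest ⟨k, by omega⟩).trans ?_
    rwa [hz]
  have hgap : ∀ i k : Fin m, z i < z k → z i + γ ≤ z k := by
    intro i k h
    rw [hz i i.2, hz k k.2] at h ⊢
    have hik : (i : ℝ) < k := lt_of_mul_lt_mul_right (by linarith) hγ.le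
    have hik' : (i : ℝ) + 1 ≤ k := by exact_mod_cast hik
    nlinarith
  obtain ⟨h1, h2⟩ := abs_le.mp hτ'
  obtain ⟨h3, h4⟩ := abs_le.mp hdist
  refine (rankerror_le_of_ranks_subset (ranks_subset_ranks ?_ ?_) r).trans herr
  · intro x hx hlt
    obtain ⟨i, rfl⟩ := hsupp x hx
    linarith [hgap i j hlt]
  · intro x hx hle
    obtain ⟨i, rfl⟩ := hsupp x hx
    by_contra! hlt
    linarith [hgap j i hlt]
end
end

section
/- Let a < b, ε > 0, and let ℓ : [a,b] → [0,∞) be a measurable loss function. Suppose there exists an interval I* ⊆ [a,b] of length at least α > 0 on which ℓ is identically 0. Let τ̂ be a random variable on [a,b] with probability density f(τ) = exp(−(ε/2)ℓ(τ)) / ∫_a^b exp(−(ε/2)ℓ(τ')) dτ'. Then for every c ≥ 0, Pr(ℓ(τ̂) ≥ c) ≤ ((b−a)/α) · exp(−εc/2). -/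
open MeasureTheory

noncomputable section

/-- The normalizing constant of the exponential mechanism is at least the width of any
subinterval on which the loss vanishes. -/
theorem width_le_integral_exp {a b ε a' b' : ℝ} (hε : 0 ≤ ε) {loss : ℝ → ℝ}
    (hmeas : Measurable loss) (hnonneg : ∀ τ ∈ Set.Icc a b, 0 ≤ loss τ)
    (ha : a ≤ a') (hb : b' ≤ b) (hzero : ∀ τ ∈ Set.Icc a' b', loss τ = 0) :
    b' - a' ≤ ∫ τ in Set.Icc a b, Real.exp (-(ε/2) * loss τ) := by
  have hint : IntegrableOn (fun τ => Real.exp (-(ε/2) * loss τ)) (Set.Icc a b) := by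
    refine Measure.integrableOn_of_bounded (M := 1) (by simp)
      (hmeas.const_mul _).exp.aestronglyMeasurable ?_
    refine ae_restrict_of_forall_mem measurableSet_Icc fun τ hτ => ?_
    rw [Real.norm_eq_abs, Real.abs_exp, Real.exp_le_one_iff]
    nlinarith [mul_nonneg hε (hnonneg τ hτ)]
  calc b' - a' ≤ volume.real (Set.Icc a' b') := by
        rw [Real.volume_real_Icc]; exact le_max_left _ _
    _ = ∫ τ in Set.Icc a' b', Real.exp (-(ε/2) * loss τ) := by
        rw [setIntegral_congr_fun (g := fun _ => (1 : ℝ)) measurableSet_Icc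
          (fun τ hτ => by simp [hzero τ hτ])]
        simp
    _ ≤ ∫ τ in Set.Icc a b, Real.exp (-(ε/2) * loss τ) :=
        setIntegral_mono_set hint (ae_of_all _ fun τ => (Real.exp_pos _).le)
          (Set.Icc_subset_Icc ha hb).eventuallyLE

/-- utility tail bound for the continuous exponential mechanism,
assuming the loss vanishes on a subinterval of width at least `α`. -/
theorem expMech_tail_bound (a b ε α : ℝ) (hab : a < b) (hε : 0 < ε) (hα : 0 < α)
    (loss : ℝ → ℝ) (hmeas : Measurable loss) (hnonneg : ∀ τ ∈ Set.Icc a b, 0 ≤ loss τ)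
    (hzero : ∃ a' b' : ℝ, a ≤ a' ∧ b' ≤ b ∧ α ≤ b' - a' ∧
      ∀ τ ∈ Set.Icc a' b', loss τ = 0)
    (c : ℝ) (hc : 0 ≤ c) :
    expMech a b ε loss {τ | c ≤ loss τ} ≤
      ENNReal.ofReal ((b - a) / α * Real.exp (-(ε * c) / 2)) := by
  obtain ⟨a', b', ha, hb, hw, hz⟩ := hzero
  have hZ := hw.trans (width_le_integral_exp hε.le hmeas hnonneg ha hb hz)
  rw [expMech, withDensity_apply _ (measurableSet_le measurable_const hmeas)]
  calc _ ≤ ∫⁻ _ in {τ | c ≤ loss τ}, ENNReal.ofReal (Real.exp (-(ε * c) / 2) / α)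
          ∂(volume.restrict (Set.Icc a b)) := by
        refine setLIntegral_mono measurable_const fun τ hτ => ENNReal.ofReal_le_ofReal ?_
        have hexp : -(ε/2) * loss τ ≤ -(ε * c) / 2 := by
          nlinarith [mul_le_mul_of_nonneg_left (show c ≤ loss τ from hτ) hε.le]
        gcongr
    _ ≤ ENNReal.ofReal (Real.exp (-(ε * c) / 2) / α) * ENNReal.ofReal (b - a) := by
        rw [setLIntegral_const]
        gcongr
        exact (measure_mono (Set.subset_univ _)).trans (by simp)
    _ = ENNReal.ofReal ((b - a) / α * Real.exp (-(ε * c) / 2)) := by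
        rw [← ENNReal.ofReal_mul (by positivity)]
        congr 1
        ring
end
end

section
/- Let D be a dataset of real numbers of size n, and let n₁, n₂ be positive integers with n₁ ≤ n₂ ≤ n/2. Then μ(D \ L_{n₂}(D)) − μ(D) ≤ (2n₂/n₁) · ( μ(D \ L_{n₁}(D)) − μ(D) ) and μ(D) − μ(D \ U_{n₂}(D)) ≤ (2n₂/n₁) · ( μ(D) − μ(D \ U_{n₁}(D)) ). -/
open MeasureTheory Multiset

noncomputable section

theorem card_mul_sum_le_of_forall_le {s t : List ℝ} (h : ∀ x ∈ s, ∀ y ∈ t, x ≤ y) :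
    t.length * s.sum ≤ s.length * t.sum := by
  induction t with
  | nil => simp
  | cons a t ih =>
    have hs : s.sum ≤ s.length * a := by
      simpa using List.sum_le_card_nsmul s a fun x hx => h x hx a (by simp)
    have ht := ih fun x hx y hy => h x hx y (by simp [hy])
    simp only [List.length_cons, List.sum_cons]
    push_cast
    linarith

/-- Averages of initial segments of a sorted list increase with the length. -/
theorem mul_sum_take_le {l : List ℝ} (hl : l.Pairwise (· ≤ ·)) {m k : ℕ} (hmk : m ≤ k)
    (hk : k ≤ l.length) : k * (l.take m).sum ≤ m * (l.take k).sum := by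
  have hsplit : l.take k = l.take m ++ (l.drop m).take (k - m) := by
    rw [← List.take_add, Nat.add_sub_cancel' hmk]
  have h := card_mul_sum_le_of_forall_le (s := l.take m) (t := (l.drop m).take (k - m))
    fun x hx y hy => by
      rw [← List.take_append_drop m l, List.pairwise_append] at hl
      exact hl.2.2 x hx y (List.mem_of_mem_take hy)
  rw [List.length_take, List.length_take, List.length_drop, min_eq_left (by omega),
    min_eq_left (by omega), Nat.cast_sub hmk] at h
  rw [hsplit, List.sum_append]
  linarith

/-- Averages of final segments of a sorted list decrease with the length. -/
theorem mul_sum_drop_le {l : List ℝ} (hl : l.Pairwise (· ≤ ·)) {m k : ℕ} (hmk : m ≤ k)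
    (hk : k ≤ l.length) :
    m * (l.drop (l.length - k)).sum ≤ k * (l.drop (l.length - m)).sum := by
  have hneg : (l.reverse.map (- ·)).Pairwise (· ≤ ·) := by
    rw [List.pairwise_map, List.pairwise_reverse]
    exact hl.imp neg_le_neg
  have hsum (j : ℕ) :
      ((l.reverse.map (- ·)).take j).sum = -(l.drop (l.length - j)).sum := by
    rw [← List.map_take, List.take_reverse, List.map_reverse, List.sum_reverse, ← List.sum_neg]
  have h := mul_sum_take_le hneg hmk (by simpa using hk)
  rw [hsum, hsum] at h
  linarith

theorem mmean_sub {D E : Multiset ℝ} (h : E ≤ D) :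
    mmean (D - E) = (D.sum - E.sum) / (D.card - E.card) := by
  have hs : (D - E).sum + E.sum = D.sum := by
    rw [← Multiset.sum_add, Multiset.sub_add_cancel h]
  rw [mmean, Multiset.card_sub h, Nat.cast_sub (Multiset.card_le_card h), ← hs, add_sub_cancel_right]

theorem lowerM_le (m : ℕ) (D : Multiset ℝ) : lowerM m D ≤ D := by
  conv_rhs => rw [← Multiset.sort_eq D (· ≤ ·)]
  exact Multiset.coe_le.2 (List.take_sublist _ _).subperm

theorem upperM_le (m : ℕ) (D : Multiset ℝ) : upperM m D ≤ D := by
  conv_rhs => rw [← Multiset.sort_eq D (· ≤ ·)]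
  exact Multiset.coe_le.2 (List.drop_sublist _ _).subperm

theorem card_lowerM {m : ℕ} {D : Multiset ℝ} (h : m ≤ D.card) : (lowerM m D).card = m := by
  simp [lowerM, h]

theorem card_upperM {m : ℕ} {D : Multiset ℝ} (h : m ≤ D.card) : (upperM m D).card = m := by
  simp [upperM, Nat.sub_sub_self h]

theorem mul_sum_lowerM_le {D : Multiset ℝ} {m k : ℕ} (hmk : m ≤ k) (hk : k ≤ D.card) :
    k * (lowerM m D).sum ≤ m * (lowerM k D).sum := by
  simpa [lowerM] using mul_sum_take_le (D.pairwise_sort (· ≤ ·)) hmk (by simpa using hk)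

theorem mul_sum_upperM_le {D : Multiset ℝ} {m k : ℕ} (hmk : m ≤ k) (hk : k ≤ D.card) :
    m * (upperM k D).sum ≤ k * (upperM m D).sum := by
  simpa [upperM] using mul_sum_drop_le (D.pairwise_sort (· ≤ ·)) hmk (by simpa using hk)

theorem lowerM_card (D : Multiset ℝ) : lowerM D.card D = D :=
  Multiset.eq_of_le_of_card_le (lowerM_le _ _) (card_lowerM le_rfl).ge

theorem upperM_card (D : Multiset ℝ) : upperM D.card D = D :=
  Multiset.eq_of_le_of_card_le (upperM_le _ _) (card_upperM le_rfl).ge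

/-- The shift of the mean `T / n` after removing parts of sizes `a ≤ b ≤ n / 2` with sums `P`, `Q`
such that the averages satisfy `P / a ≤ Q / b` and `P / a ≤ T / n`. -/
theorem mean_shift_le {a b n P Q T : ℝ} (ha : 0 < a) (hab : a ≤ b) (hb : b ≤ n / 2)
    (hPQ : b * P ≤ a * Q) (hPT : n * P ≤ a * T) :
    (T - Q) / (n - b) - T / n ≤ 2 * b / a * ((T - P) / (n - a) - T / n) := by
  have hn : 0 < n := by linarith
  have hna : 0 < n - a := by linarith
  have hnb : 0 < n - b := by linarith
  have shift {c S : ℝ} (hc : 0 < n - c) :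
      (T - S) / (n - c) - T / n = (c * T - n * S) / n / (n - c) := by
    field_simp
    ring
  have hnum : (b * T - n * Q) / n ≤ b / a * ((a * T - n * P) / n) := by
    rw [← mul_div_assoc]
    gcongr
    rw [div_mul_eq_mul_div, le_div_iff₀ ha]
    linarith [mul_le_mul_of_nonneg_left hPQ hn.le]
  have hA : 0 ≤ (a * T - n * P) / n := div_nonneg (by linarith) hn.le
  rw [shift hnb, shift hna]
  calc (b * T - n * Q) / n / (n - b)
      ≤ b / a * ((a * T - n * P) / n) / (n - b) := by gcongr
    _ ≤ b / a * ((a * T - n * P) / n) / ((n - a) / 2) := by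
        have hb0 : 0 < b := by linarith
        gcongr
        linarith
    _ = 2 * b / a * ((a * T - n * P) / n / (n - a)) := by
        field_simp

/-- removing more extreme points at most proportionally increases
the shift of the mean. -/
theorem remove_extra_bound (D : Multiset ℝ) (n₁ n₂ : ℕ)
    (h1 : 0 < n₁) (h12 : n₁ ≤ n₂) (h2 : (n₂ : ℝ) ≤ (D.card : ℝ) / 2) :
    mmean (D - lowerM n₂ D) - mmean D ≤
        (2 * n₂ / n₁) * (mmean (D - lowerM n₁ D) - mmean D) ∧
      mmean D - mmean (D - upperM n₂ D) ≤
        (2 * n₂ / n₁) * (mmean D - mmean (D - upperM n₁ D)) := by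
  have hn : n₂ ≤ D.card := by
    have : (n₂ : ℝ) ≤ D.card := by linarith [D.card.cast_nonneg (α := ℝ)]
    exact_mod_cast this
  have ha : (0 : ℝ) < n₁ := by exact_mod_cast h1
  have hab : (n₁ : ℝ) ≤ n₂ := by exact_mod_cast h12
  constructor
  · rw [mmean_sub (lowerM_le _ _), mmean_sub (lowerM_le _ _), card_lowerM hn,
      card_lowerM (h12.trans hn)]
    have hT := mul_sum_lowerM_le (h12.trans hn) le_rfl
    rw [lowerM_card] at hT
    exact mean_shift_le ha hab h2 (mul_sum_lowerM_le h12 hn) hT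
  · rw [mmean_sub (upperM_le _ _), mmean_sub (upperM_le _ _), card_upperM hn,
      card_upperM (h12.trans hn)]
    have hQ := mul_sum_upperM_le h12 hn
    have hT := mul_sum_upperM_le (h12.trans hn) le_rfl
    rw [upperM_card] at hT
    have h := mean_shift_le (P := -(upperM n₁ D).sum) (Q := -(upperM n₂ D).sum) (T := -D.sum)
      ha hab h2 (by linarith) (by linarith)
    simp only [← neg_sub', neg_div] at h
    simp only [mmean]
    convert h using 1 <;> ring
end
end

section
/- Let D be a dataset of real numbers with |D| = n, let l' ∈ ℝ, and let q = #{x ∈ D : x < l'} (counted with multiplicity), with q < n. Then the clipping bias is at most the removal bias: (1/n) · Σ_{x ∈ D, x < l'} (l' − x) ≤ μ(D \ L_q(D)) − μ(D). Symmetrically, if u' ∈ ℝ and p = #{x ∈ D : x > u'} with p < n, then (1/n) · Σ_{x ∈ D, x > u'} (x − u') ≤ μ(D) − μ(D \ U_p(D)). -/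
open MeasureTheory Multiset

noncomputable section

/-- Filtering a sorted list by a downward closed predicate gives an initial segment. -/
theorem List.Pairwise.filter_eq_take_countP {α : Type*} [Preorder α] (p : α → Prop)
    [DecidablePred p] (hp : ∀ x y, x ≤ y → p y → p x) {l : List α} (hl : l.Pairwise (· ≤ ·)) :
    l.filter p = l.take (l.countP p) := by
  induction l with
  | nil => simp
  | cons a t ih =>
    rw [List.pairwise_cons] at hl
    by_cases ha : p a
    · simp [ha, ih hl.2]
    · have ht : ∀ x ∈ t, ¬ p x := fun x hx h => ha (hp a x (hl.1 x hx) h)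
      have h0 : t.countP p = 0 := by simpa [List.countP_eq_zero] using ht
      have h1 : t.filter p = [] := by simpa [List.filter_eq_nil_iff] using ht
      simp [ha, h0, h1]

theorem lowerM_card_filter (D : Multiset ℝ) (p : ℝ → Prop) [DecidablePred p]
    (hp : ∀ x y, x ≤ y → p y → p x) : lowerM (D.filter p).card D = D.filter p := by
  have h := (D.pairwise_sort (· ≤ ·)).filter_eq_take_countP p hp
  have hc : (D.filter p).card = (D.sort (· ≤ ·)).countP p := by
    conv_lhs => rw [← D.sort_eq (· ≤ ·)]
    rw [Multiset.filter_coe, Multiset.coe_card, List.countP_eq_length_filter]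
  rw [lowerM, hc, ← h, ← Multiset.filter_coe, D.sort_eq]

theorem lowerM_add_upperM (D : Multiset ℝ) {m k : ℕ} (h : m + k = D.card) :
    lowerM m D + upperM k D = D := by
  obtain rfl : m = D.card - k := by omega
  rw [lowerM, upperM, Multiset.coe_add, List.take_append_drop, D.sort_eq]

/-- Lower bound on the increase of the mean when a part `S` lying below `a` is removed from `S + T`,
with `T` lying above `a`. -/
theorem sum_map_sub_div_card_le_mmean_sub (S T : Multiset ℝ) (a : ℝ) (hT : 0 < T.card)
    (h : ∀ x ∈ T, a ≤ x) :
    (1 / ((S + T).card : ℝ)) * (S.map (fun x => a - x)).sum ≤ mmean T - mmean (S + T) := by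
  have hsum : (T.card : ℝ) * a ≤ T.sum := by
    simpa using Multiset.card_nsmul_le_sum h
  have hT' : (0 : ℝ) < T.card := by exact_mod_cast hT
  have hmean : a ≤ mmean T := by
    rw [mmean, le_div_iff₀ hT']
    linarith
  have hTsum : T.sum = T.card * mmean T := by
    rw [mmean]
    field_simp
  have hST : (0 : ℝ) < S.card + T.card := by positivity
  have hmul : (S.card : ℝ) * a ≤ S.card * mmean T := by gcongr
  rw [show mmean (S + T) = (S.sum + T.sum) / (S.card + T.card) by simp [mmean], hTsum]
  have hS : (S.map fun x => a - x).sum = S.card * a - S.sum := by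
    simpa using Multiset.sum_map_sub (m := S) (f := fun _ => a) (g := id)
  rw [hS, Multiset.card_add, Nat.cast_add]
  rw [one_div_mul_eq_div, sub_eq_add_neg (mmean T), ← neg_div, div_le_iff₀ hST, add_mul,
    div_mul_cancel₀ _ hST.ne']
  linarith

theorem mmean_map_neg (D : Multiset ℝ) : mmean (D.map Neg.neg) = -mmean D := by
  rw [mmean, mmean, Multiset.card_map, Multiset.sum_map_neg', neg_div]

/-- Lower bound on the decrease of the mean when a part `S` lying above `a` is removed from `S + T`,
with `T` lying below `a`. -/
theorem sum_map_sub_div_card_le_sub_mmean (S T : Multiset ℝ) (a : ℝ) (hT : 0 < T.card)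
    (h : ∀ x ∈ T, x ≤ a) :
    (1 / ((S + T).card : ℝ)) * (S.map (fun x => x - a)).sum ≤ mmean (S + T) - mmean T := by
  have key := sum_map_sub_div_card_le_mmean_sub (S.map Neg.neg) (T.map Neg.neg) (-a)
    (by simpa using hT) (by simpa using h)
  rw [← Multiset.map_add, mmean_map_neg, mmean_map_neg, Multiset.map_map, Multiset.card_map] at key
  have hf : (fun x => -a - x) ∘ Neg.neg = fun x : ℝ => x - a := by
    funext x
    simp only [Function.comp_apply]
    ring
  rw [hf] at key
  linarith

/-- the clipping bias is at most the removal bias, on each side. -/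
theorem clipping_bias_le_removal_bias (D : Multiset ℝ) :
    (∀ l' : ℝ, (D.filter (fun x => x < l')).card < D.card →
      (1 / (D.card : ℝ)) * ((D.filter (fun x => x < l')).map (fun x => l' - x)).sum ≤
        mmean (D - lowerM ((D.filter (fun x => x < l')).card) D) - mmean D) ∧
    (∀ u' : ℝ, (D.filter (fun x => u' < x)).card < D.card →
      (1 / (D.card : ℝ)) * ((D.filter (fun x => u' < x)).map (fun x => x - u')).sum ≤
        mmean D - mmean (D - upperM ((D.filter (fun x => u' < x)).card) D)) := by
  refine ⟨fun a ha => ?_, fun a ha => ?_⟩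
  · have hD := Multiset.filter_add_not (fun x => x < a) D
    have hcard := congrArg Multiset.card hD
    rw [Multiset.card_add] at hcard
    rw [lowerM_card_filter D _ fun x y hxy hy => hxy.trans_lt hy]
    have hsub : D - D.filter (fun x => x < a) = D.filter (fun x => ¬ x < a) :=
      tsub_eq_of_eq_add_rev hD.symm
    have key := sum_map_sub_div_card_le_mmean_sub (D.filter (fun x => x < a))
      (D.filter (fun x => ¬ x < a)) a (by omega) (by simp)
    rwa [hD, ← hsub] at key
  · have hD := Multiset.filter_add_not (fun x => a < x) D
    have hcard := congrArg Multiset.card hD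
    rw [Multiset.card_add] at hcard
    have hlow := lowerM_card_filter D (fun x => ¬ a < x)
      fun x y hxy hy hx => hy (hx.trans_le hxy)
    have hsplit := lowerM_add_upperM D ((add_comm _ _).trans hcard)
    rw [hlow] at hsplit
    have hsub : D - upperM (D.filter (fun x => a < x)).card D = D.filter (fun x => ¬ a < x) :=
      tsub_eq_of_eq_add hsplit.symm
    have key := sum_map_sub_div_card_le_sub_mmean (D.filter (fun x => a < x))
      (D.filter (fun x => ¬ a < x)) a (by omega) (by simp)
    rwa [hD, ← hsub] at key
end
end

section
/- Let D be a nonempty dataset of real numbers with |D| = n and let l ≤ u be reals. Let clip(D, [l,u]) denote the multiset {clip(x, [l,u]) : x ∈ D}. Then |μ(clip(D, [l,u])) − μ(D)| ≤ (1/n) · max( Σ_{x ∈ D, x < l} (l − x), Σ_{x ∈ D, x > u} (x − u) ), where sums are taken with multiplicity. -/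
open MeasureTheory Multiset

noncomputable section

/-- The change of a point under clipping is its excess below `l` minus its excess above `u`. -/
theorem clip_sub_self {l u : ℝ} (hlu : l ≤ u) (x : ℝ) :
    clip x l u - x = (if x < l then l - x else 0) - (if u < x then x - u else 0) := by
  unfold clip
  grind

/-- The change of the sum of a dataset under clipping is the total excess below `l` minus the
total excess above `u`. -/
theorem sum_map_clip_sub_sum (D : Multiset ℝ) {l u : ℝ} (hlu : l ≤ u) :
    (D.map (fun x => clip x l u)).sum - D.sum =
      ((D.filter (fun x => x < l)).map (fun x => l - x)).sum -
        ((D.filter (fun x => u < x)).map (fun x => x - u)).sum := by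
  induction D using Multiset.induction_on with
  | empty => simp
  | cons a s ih =>
    have h := clip_sub_self hlu a
    simp only [Multiset.filter_cons, Multiset.map_cons, Multiset.sum_cons, Multiset.map_add,
      Multiset.sum_add]
    split_ifs at h ⊢ <;>
      simp only [Multiset.map_singleton, Multiset.sum_singleton, Multiset.map_zero,
        Multiset.sum_zero] <;>
      linarith

/-- The map of a predicate-filtered dataset by a function nonnegative on it has nonnegative sum. -/
theorem sum_map_filter_nonneg (D : Multiset ℝ) (p : ℝ → Prop) [DecidablePred p] {f : ℝ → ℝ}
    (hf : ∀ x, p x → 0 ≤ f x) : 0 ≤ ((D.filter p).map f).sum := by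
  refine Multiset.sum_nonneg fun y hy => ?_
  obtain ⟨x, hx, rfl⟩ := Multiset.mem_map.1 hy
  exact hf x (Multiset.mem_filter.1 hx).2

/-- the two-sided clipping bias is at most the larger of the two
one-sided clipping biases. -/
theorem two_sided_clipping_bias (D : Multiset ℝ) (hD : D ≠ 0) (l u : ℝ) (hlu : l ≤ u) :
    |mmean (D.map (fun x => clip x l u)) - mmean D| ≤
      (1 / (D.card : ℝ)) *
        max (((D.filter (fun x => x < l)).map (fun x => l - x)).sum)
            (((D.filter (fun x => u < x)).map (fun x => x - u)).sum) := by
  have hlow := sum_map_filter_nonneg D (fun x => x < l) (f := fun x => l - x)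
    fun x hx => sub_nonneg.2 hx.le
  have hupp := sum_map_filter_nonneg D (fun x => u < x) (f := fun x => x - u)
    fun x hx => sub_nonneg.2 hx.le
  unfold mmean
  rw [Multiset.card_map, ← sub_div, sum_map_clip_sub_sum D hlu, abs_div, Nat.abs_cast,
    div_eq_inv_mul, one_div]
  gcongr
  rw [abs_le]
  constructor
  · linarith [le_max_right (((D.filter (fun x => x < l)).map (fun x => l - x)).sum)
      (((D.filter (fun x => u < x)).map (fun x => x - u)).sum)]
  · linarith [le_max_left (((D.filter (fun x => x < l)).map (fun x => l - x)).sum)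
      (((D.filter (fun x => u < x)).map (fun x => x - u)).sum)]
end
end
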